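/- arXiv:2102.10846 — 2 statements merged into one kernel-verified Lean document; each statement's English description precedes it below -/
import Mathlib

section
/- Let λ > 0 and y ≥ 0, and define σ : ℝ → ℝ by σ(t) = −λ²( ((λt)² + 2y)/√((λt)² + 4y) − λt ). Then σ is monotone nondecreasing on ℝ, and if y > 0 then σ is strictly increasing on ℝ. -/
/-- With `d = √(x² + 4y) - x`, the quantity `(x² + 2y)/√(x² + 4y) - x` equals `d³/(d² + 4y)`. -/
theorem div_sqrt_sub_eq_cube_div {y : ℝ} (hy : 0 < y) (x : ℝ) :
    (x ^ 2 + 2 * y) / √(x ^ 2 + 4 * y) - x =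
      (√(x ^ 2 + 4 * y) - x) ^ 3 / ((√(x ^ 2 + 4 * y) - x) ^ 2 + 4 * y) := by
  have hs : 0 < √(x ^ 2 + 4 * y) := Real.sqrt_pos.2 (by positivity)
  have hsq : √(x ^ 2 + 4 * y) ^ 2 = x ^ 2 + 4 * y := Real.sq_sqrt (by positivity)
  generalize √(x ^ 2 + 4 * y) = s at hs hsq ⊢
  have hy' : y = (s ^ 2 - x ^ 2) / 4 := by linarith
  have hd : (s - x) ^ 2 + 4 * y ≠ 0 := by positivity
  rw [div_sub' hs.ne', div_eq_div_iff hs.ne' hd]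
  rw [hy']
  ring

theorem strictAnti_sqrt_sq_add_sub {c : ℝ} (hc : 0 < c) :
    StrictAnti fun x : ℝ => √(x ^ 2 + c) - x := by
  intro a b hab
  have ha : |a| < √(a ^ 2 + c) := Real.lt_sqrt_of_sq_lt (by rw [sq_abs]; linarith)
  have hb : |b| < √(b ^ 2 + c) := Real.lt_sqrt_of_sq_lt (by rw [sq_abs]; linarith)
  have hsa : √(a ^ 2 + c) ^ 2 = a ^ 2 + c := Real.sq_sqrt (by positivity)
  have hsb : √(b ^ 2 + c) ^ 2 = b ^ 2 + c := Real.sq_sqrt (by positivity)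
  have := le_abs_self a
  have := le_abs_self b
  have := abs_nonneg a
  have := abs_nonneg b
  change √(b ^ 2 + c) - b < √(a ^ 2 + c) - a
  by_contra! h
  nlinarith

theorem strictAnti_div_sqrt_sub {y : ℝ} (hy : 0 < y) :
    StrictAnti fun x : ℝ => (x ^ 2 + 2 * y) / √(x ^ 2 + 4 * y) - x := by
  intro a b hab
  have hlt := strictAnti_sqrt_sq_add_sub (mul_pos four_pos hy) hab
  have hb : 0 < √(b ^ 2 + 4 * y) - b := sub_pos.2 (Real.lt_sqrt_of_sq_lt (by linarith))
  simp only [div_sqrt_sub_eq_cube_div hy] at hlt ⊢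
  generalize √(b ^ 2 + 4 * y) - b = e at hb hlt ⊢
  generalize √(a ^ 2 + 4 * y) - a = d at hlt ⊢
  have hcube : e ^ 3 < d ^ 3 := by gcongr
  have hd : 0 < d := hb.trans hlt
  rw [div_lt_div_iff₀ (by positivity) (by positivity)]
  nlinarith [mul_pos (mul_pos (pow_pos hb 2) (pow_pos hd 2)) (sub_pos.2 hlt),
    mul_pos hy (sub_pos.2 hcube)]

theorem antitone_abs_sub_self : Antitone fun x : ℝ => |x| - x := by
  intro a b hab
  have := abs_sub_abs_le_abs_sub b a
  rw [abs_of_nonneg (sub_nonneg.2 hab)] at this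
  change |b| - b ≤ |a| - a
  linarith


/-- **Monotonicity of the Hessian eigenvalues of the β = 1.5 dual function**
(Proposition 13 of the paper): `σ(t) = -λ²(((λt)² + 2y)/√((λt)² + 4y) - λt)` is
nondecreasing on ℝ for `y ≥ 0`, and strictly increasing when `y > 0`.
(Division by zero, which occurs only when `y = 0` and `t = 0`, follows Lean's
convention `0/0 = 0`, matching the paper's convention.) -/
theorem stmt_7 (lam y : ℝ) (hlam : 0 < lam) (hy : 0 ≤ y)
    (σ : ℝ → ℝ)
    (hσ : ∀ t : ℝ, σ t = -lam ^ 2 *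
        (((lam * t) ^ 2 + 2 * y) / Real.sqrt ((lam * t) ^ 2 + 4 * y) - lam * t)) :
    Monotone σ ∧ (0 < y → StrictMono σ) := by
  have hstrict : 0 < y → StrictMono σ := by
    intro hy a b hab
    rw [hσ, hσ]
    exact mul_lt_mul_of_neg_left
      (strictAnti_div_sqrt_sub hy (mul_lt_mul_of_pos_left hab hlam)) (by nlinarith)
  refine ⟨?_, hstrict⟩
  rcases hy.eq_or_lt with rfl | hpos
  · intro a b hab
    rw [hσ, hσ]
    simp only [mul_zero, add_zero, Real.sqrt_sq_eq_abs]
    simp only [← sq_abs (lam * _), sq, mul_self_div_self]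
    exact mul_le_mul_of_nonpos_left
      (antitone_abs_sub_self (mul_le_mul_of_nonneg_left hab hlam.le)) (by nlinarith)
  · exact (hstrict hpos).monotone
end

section
/- Let A be an m×n real matrix with nonnegative entries a_{ij} such that every row of A has at least one nonzero entry, let y ∈ ℝ^m with y_i ≥ 0, let λ > 0 and ε > 0 with 3ε < 1. With D_λ, Δ_A, c, and b_i defined as for the β = 1.5 problem (D_λ(θ) = Σ_i (λθ_i)³/6 − ((λθ_i)² + 4y_i)^{3/2}/6 + λθ_i y_i + (4/3)y_i^{3/2} − ελθ_i; Δ_A = {θ : Σ_i a_{ij}θ_i ≤ 1 ∀j}; c = −(1/λ)((4Σ_i y_i^{3/2} + 2(m−1)ε^{3/2} + 3ε)/(1−3ε))^{1/3}; b_i = λ·min_{j: a_{ij}≠0}((1 − c Σ_{i'} a_{i'j})/a_{ij}) + λc), define S₀ = {θ ∈ ℝ^m : λθ_i ≤ min(b_i, (y_i−ε)/√ε) for all i}, d_i = min(b_i, (y_i−ε)/√ε), and α = min_{i∈{1,…,m}} λ²( (d_i² + 2y_i)/√(d_i² + 4y_i) − d_i ). Then D_λ is α-strongly concave on Δ_A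 ∩ S₀. -/
/-- `(s² + 2y) / √(s² + 4y) - s` written in terms of `√(s² + 4y) - s`. -/
theorem sq_add_div_sqrt_sub_eq {y s : ℝ} (hy : 0 ≤ y) (hs : 0 < y ∨ s < 0) :
    0 < √(s ^ 2 + 4 * y) - s ∧
      (s ^ 2 + 2 * y) / √(s ^ 2 + 4 * y) - s =
        (√(s ^ 2 + 4 * y) - s) ^ 3 / ((√(s ^ 2 + 4 * y) - s) ^ 2 + 4 * y) := by
  have hp : 0 < s ^ 2 + 4 * y := by
    rcases hs with h | h
    · positivity
    · nlinarith [mul_pos_of_neg_of_neg h h]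
  have hr : 0 < √(s ^ 2 + 4 * y) := Real.sqrt_pos.mpr hp
  have hr2 : √(s ^ 2 + 4 * y) ^ 2 = s ^ 2 + 4 * y := Real.sq_sqrt hp.le
  set r := √(s ^ 2 + 4 * y)
  have ha : 0 < r - s := by
    rcases hs with h | h
    · by_contra! hc
      nlinarith
    · linarith
  refine ⟨ha, ?_⟩
  have hy' : 4 * y = r ^ 2 - s ^ 2 := by linarith
  have h2 : (r - s) ^ 2 + 4 * y = 2 * r * (r - s) := by rw [hy']; ring
  rw [h2, show s ^ 2 + 2 * y = (r ^ 2 + s ^ 2) / 2 by linarith]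
  field_simp
  ring

/-- The function `s ↦ (s² + 2y) / √(s² + 4y) - s` is nonincreasing. -/
theorem sq_add_div_sqrt_sub_anti {y s d : ℝ} (hy : 0 ≤ y) (hd : 0 < y ∨ d < 0) (hsd : s ≤ d) :
    (d ^ 2 + 2 * y) / √(d ^ 2 + 4 * y) - d ≤ (s ^ 2 + 2 * y) / √(s ^ 2 + 4 * y) - s := by
  obtain ⟨had, hd'⟩ := sq_add_div_sqrt_sub_eq hy hd
  obtain ⟨has, hs'⟩ := sq_add_div_sqrt_sub_eq hy (hd.imp_right hsd.trans_lt)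
  have hle : √(d ^ 2 + 4 * y) - d ≤ √(s ^ 2 + 4 * y) - s := by
    have h : √(d ^ 2 + 4 * y) ≤ √(s ^ 2 + 4 * y) + (d - s) := by
      have h2 : √(s ^ 2 + 4 * y) ^ 2 = s ^ 2 + 4 * y := Real.sq_sqrt (by positivity)
      refine Real.sqrt_le_iff.mpr ⟨by linarith [Real.sqrt_nonneg (s ^ 2 + 4 * y)], ?_⟩
      nlinarith [mul_nonneg has.le (sub_nonneg.mpr hsd)]
    linarith
  rw [hd', hs']
  generalize √(d ^ 2 + 4 * y) - d = p at *
  generalize √(s ^ 2 + 4 * y) - s = q at *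
  rw [div_le_div_iff₀ (by positivity) (by positivity)]
  have h3 : p ^ 3 ≤ q ^ 3 := by gcongr
  nlinarith [mul_nonneg (mul_nonneg (sq_nonneg p) (sq_nonneg q)) (sub_nonneg.mpr hle),
    mul_nonneg hy (sub_nonneg.mpr h3)]

/-- One coordinate of the dual function, up to affine terms, is strongly concave on `Iic d`. -/
theorem concaveOn_cube_sub_rpow {y d κ : ℝ} (hy : 0 ≤ y) (hd : 0 < y ∨ d < 0)
    (hκ : κ ≤ (d ^ 2 + 2 * y) / √(d ^ 2 + 4 * y) - d) :
    ConcaveOn ℝ (Set.Iic d)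
      (fun s : ℝ => s ^ 3 / 6 - (s ^ 2 + 4 * y) ^ ((3 : ℝ) / 2) / 6 + κ / 2 * s ^ 2) := by
  have hfun : (fun s : ℝ => s ^ 3 / 6 - (s ^ 2 + 4 * y) ^ ((3 : ℝ) / 2) / 6 + κ / 2 * s ^ 2) =
      fun s : ℝ => s ^ 3 / 6 - (s ^ 2 + 4 * y) * √(s ^ 2 + 4 * y) / 6 + κ / 2 * s ^ 2 := by
    funext s
    have hp : 0 ≤ s ^ 2 + 4 * y := by positivity
    rw [show (3 : ℝ) / 2 = 1 + 1 / 2 by norm_num, Real.rpow_add_of_nonneg hp (by norm_num)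
      (by norm_num), Real.rpow_one, ← Real.sqrt_eq_rpow]
  rw [hfun]
  have hpos : ∀ s ∈ interior (Set.Iic d), 0 < s ^ 2 + 4 * y := by
    intro s hs
    rw [interior_Iic] at hs
    rcases hd with h | h
    · positivity
    · have : s < 0 := lt_trans hs h
      nlinarith [mul_pos_of_neg_of_neg this this]
  have hbase : ∀ s : ℝ, HasDerivAt (fun s : ℝ => s ^ 2 + 4 * y) (2 * s) s := by
    intro s
    simpa using (hasDerivAt_pow 2 s).add_const (4 * y)
  refine concaveOn_of_hasDerivWithinAt2_nonpos (convex_Iic d)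
    (f' := fun s => s ^ 2 / 2 - s * √(s ^ 2 + 4 * y) / 2 + κ * s)
    (f'' := fun s => κ - ((s ^ 2 + 2 * y) / √(s ^ 2 + 4 * y) - s))
    (by fun_prop) ?_ ?_ ?_
  · intro s hs
    have hp := hpos s hs
    have hr : 0 < √(s ^ 2 + 4 * y) := Real.sqrt_pos.mpr hp
    have hr2 : √(s ^ 2 + 4 * y) ^ 2 = s ^ 2 + 4 * y := Real.sq_sqrt hp.le
    have h := (((hasDerivAt_pow 3 s).div_const 6).sub
      (((hbase s).mul ((hbase s).sqrt hp.ne')).div_const 6)).add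
        ((hasDerivAt_pow 2 s).const_mul (κ / 2))
    refine (h.congr_deriv ?_).hasDerivWithinAt
    generalize √(s ^ 2 + 4 * y) = r at *
    rw [← hr2]
    field_simp
    norm_num
    ring
  · intro s hs
    have hp := hpos s hs
    have hr : 0 < √(s ^ 2 + 4 * y) := Real.sqrt_pos.mpr hp
    have hr2 : √(s ^ 2 + 4 * y) ^ 2 = s ^ 2 + 4 * y := Real.sq_sqrt hp.le
    have h := (((hasDerivAt_pow 2 s).div_const 2).sub
      (((hasDerivAt_id s).mul ((hbase s).sqrt hp.ne')).div_const 2)).add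
        ((hasDerivAt_id s).const_mul κ)
    refine (h.congr_deriv ?_).hasDerivWithinAt
    simp only [id]
    generalize √(s ^ 2 + 4 * y) = r at *
    rw [show s ^ 2 + 2 * y = (r ^ 2 + s ^ 2) / 2 by linarith]
    field_simp
    norm_num
    ring
  · intro s hs
    have hsd : s ∈ Set.Iic d := interior_subset hs
    have := sq_add_div_sqrt_sub_anti hy hd hsd
    linarith

/-- **Strong concavity of the β = 1.5 dual function on `Δ_A ∩ S₀`**
(Proposition 15 of the paper): with `d_i = min(b_i, (y_i - ε)/√ε)` and
`α = min_i λ²((d_i² + 2y_i)/√(d_i² + 4y_i) - d_i)`, the dual function `D_λ` is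
`α`-strongly concave on the intersection of the feasible set with `S₀`. -/
theorem stmt_11 {m n : ℕ} (hm : 0 < m) (A : Matrix (Fin m) (Fin n) ℝ)
    (hA : ∀ i j, 0 ≤ A i j) (hrow : ∀ i, ∃ j, A i j ≠ 0)
    (y : Fin m → ℝ) (hy : ∀ i, 0 ≤ y i)
    (lam ε : ℝ) (hlam : 0 < lam) (hε : 0 < ε) (hε1 : 3 * ε < 1)
    (D : EuclideanSpace ℝ (Fin m) → ℝ)
    (hD : ∀ θ, D θ = ∑ i, ((lam * θ i) ^ 3 / 6
        - ((lam * θ i) ^ 2 + 4 * y i) ^ ((3 : ℝ) / 2) / 6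
        + lam * θ i * y i + (4 / 3) * (y i) ^ ((3 : ℝ) / 2) - ε * (lam * θ i)))
    (c : ℝ)
    (hc : c = -(1 / lam) * ((4 * ∑ i, (y i) ^ ((3 : ℝ) / 2)
        + 2 * ((m : ℝ) - 1) * ε ^ ((3 : ℝ) / 2) + 3 * ε)
          / (1 - 3 * ε)) ^ ((1 : ℝ) / 3))
    (b : Fin m → ℝ)
    (hb : ∀ i, b i = lam * sInf {v : ℝ | ∃ j, A i j ≠ 0
        ∧ v = (1 - c * ∑ i', A i' j) / A i j} + lam * c)
    (S : Set (EuclideanSpace ℝ (Fin m)))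
    (hSdef : S = {θ | (∀ j, ∑ i, A i j * θ i ≤ 1)
        ∧ ∀ i, lam * θ i ≤ min (b i) ((y i - ε) / Real.sqrt ε)})
    (d : Fin m → ℝ) (hd : ∀ i, d i = min (b i) ((y i - ε) / Real.sqrt ε))
    (α : ℝ)
    (hα : α = sInf {v : ℝ | ∃ i : Fin m, v = lam ^ 2 *
        ((d i ^ 2 + 2 * y i) / Real.sqrt (d i ^ 2 + 4 * y i) - d i)}) :
    ∀ θ₁ ∈ S, ∀ θ₂ ∈ S, ∀ t : ℝ, 0 ≤ t → t ≤ 1 →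
      t * D θ₁ + (1 - t) * D θ₂ + α / 2 * t * (1 - t) * ‖θ₁ - θ₂‖ ^ 2
        ≤ D (t • θ₁ + (1 - t) • θ₂) := by
  intro θ₁ h₁ θ₂ h₂ t ht0 ht1
  have hlam2 : 0 < lam ^ 2 := by positivity
  have hsq : 0 < √ε := Real.sqrt_pos.mpr hε
  rw [hSdef] at h₁ h₂
  have hcoord : ∀ i, ConcaveOn ℝ (Set.Iic (d i)) (fun s : ℝ =>
      s ^ 3 / 6 - (s ^ 2 + 4 * y i) ^ ((3 : ℝ) / 2) / 6 + α / lam ^ 2 / 2 * s ^ 2) := by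
    intro i
    refine concaveOn_cube_sub_rpow (hy i) ?_ ?_
    · rcases (hy i).lt_or_eq with h | h
      · exact Or.inl h
      · right
        rw [hd i, ← h]
        exact (min_le_right _ _).trans_lt (div_neg_of_neg_of_pos (by linarith) hsq)
    · rw [div_le_iff₀' hlam2, hα]
      refine csInf_le ?_ ⟨i, rfl⟩
      refine ((Set.finite_range fun i : Fin m => lam ^ 2 *
        ((d i ^ 2 + 2 * y i) / √(d i ^ 2 + 4 * y i) - d i)).subset ?_).bddBelow
      rintro v ⟨i, rfl⟩
      exact ⟨i, rfl⟩
  rw [hD, hD, hD, EuclideanSpace.norm_sq_eq, Finset.mul_sum, Finset.mul_sum, Finset.mul_sum,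
    ← Finset.sum_add_distrib, ← Finset.sum_add_distrib]
  refine Finset.sum_le_sum fun i _ => ?_
  have h := (hcoord i).2 (x := lam * θ₁ i) (y := lam * θ₂ i)
    ((h₁.2 i).trans_eq (hd i).symm) ((h₂.2 i).trans_eq (hd i).symm)
    ht0 (sub_nonneg.mpr ht1) (by ring)
  simp only [smul_eq_mul] at h
  simp only [PiLp.add_apply, PiLp.sub_apply, PiLp.smul_apply, smul_eq_mul, Real.norm_eq_abs,
    sq_abs]
  rw [show t * (lam * θ₁ i) + (1 - t) * (lam * θ₂ i) = lam * (t * θ₁ i + (1 - t) * θ₂ i) by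
    ring] at h
  have hk : ∀ x : ℝ, α / lam ^ 2 / 2 * (lam * x) ^ 2 = α / 2 * x ^ 2 := by
    intro x
    field_simp
  rw [hk, hk, hk] at h
  linarith
end
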